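/- Let γ > 1 and let α₀,…,α₈ be real Leslie coefficients with γ₁ := α₃ − α₂ and γ₂ := α₆ − α₅ satisfying the Parodi relation γ₂ = α₂ + α₃ and the empirical inequalities α₄ > 0; 2α₁ + 3α₄ + 2α₅ + 2α₆ > 0; γ₁ > 0; 2α₄ + α₅ + α₆ > 0; 4γ₁(2α₄ + α₅ + α₆) > (α₂ + α₃ + γ₂)²; α₄ + α₇ > α₁ + γ₂²/γ₁ ≥ 0; 2α₄ + α₅ + α₆ − γ₂²/γ₁ > α₀ + α₁ + α₅ + α₆ + α₈ ≥ 0. Then there exists a function C : [0,∞) × (0,∞) → [0,∞) (depending only on γ and the coefficients) such that for every T > 0 and every smooth solution (ρ, u, v, n) of the one-dimensional compressible Ericksen–Leslie system on [0,1] × [0,T] with ρ > 0 and boundary conditions u(0,t)=u(1,t)=v(0,t)=v(1,t)=0, n_x(0,t)=n_x(1,t)=0, one has the higher integrability estimate ∫₀ᵀ∫₀¹ ρ^{2γ} dx dt ≤ C(E(0), T), where E(0) is the initial energy. -/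

import Mathlib

open Set intervalIntegral Real

noncomputable section

/-- Spatial partial derivative of a function of `(x, t)`. -/
def pdx (f : ℝ → ℝ → ℝ) (x t : ℝ) : ℝ := deriv (fun y => f y t) x

/-- Time partial derivative of a function of `(x, t)`. -/
def pdt (f : ℝ → ℝ → ℝ) (x t : ℝ) : ℝ := deriv (fun s => f x s) t

/-- The material derivative `ṅ = n_t + u n_x`. -/
def mdot (u n : ℝ → ℝ → ℝ) (x t : ℝ) : ℝ := pdt n x t + u x t * pdx n x t

/-- The second-order forcing term `J¹` in the `u`-equation of the one-dimensional
compressible Ericksen–Leslie system. -/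
def J1 (a0 a1 a2 a3 a4 a5 a6 a7 a8 : ℝ) (u v n : ℝ → ℝ → ℝ) (x t : ℝ) : ℝ :=
  (a0 + a5 + a6 + a8) * pdx (fun y s => pdx u y s * cos (n y s) ^ 2) x t
  + a1 * pdx (fun y s => pdx u y s * cos (n y s) ^ 4) x t
  - (a2 + a3) * pdx (fun y s => mdot u n y s * cos (n y s) * sin (n y s)) x t
  + (a4 + a7) * pdx (pdx u) x t
  + a0 * pdx (fun y s => pdx v y s * cos (n y s) * sin (n y s)) x t
  + a1 * pdx (fun y s => pdx v y s * cos (n y s) ^ 3 * sin (n y s)) x t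
  + (1 / 2) * (a2 + a3 + a5 + a6) * pdx (fun y s => pdx v y s * cos (n y s) * sin (n y s)) x t

/-- The second-order forcing term `J²` in the `v`-equation of the one-dimensional
compressible Ericksen–Leslie system. -/
def J2 (a1 a2 a3 a4 a5 a6 a8 : ℝ) (u v n : ℝ → ℝ → ℝ) (x t : ℝ) : ℝ :=
  a1 * pdx (fun y s => pdx u y s * cos (n y s) ^ 3 * sin (n y s)) x t
  + a2 * pdx (fun y s => mdot u n y s * cos (n y s) ^ 2) x t
  - a3 * pdx (fun y s => mdot u n y s * sin (n y s) ^ 2) x t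
  + (a6 + a8) * pdx (fun y s => pdx u y s * cos (n y s) * sin (n y s)) x t
  + a1 * pdx (fun y s => pdx v y s * cos (n y s) ^ 2 * sin (n y s) ^ 2) x t
  + (1 / 2) * (-a2 + a5) * pdx (fun y s => pdx v y s * cos (n y s) ^ 2) x t
  + (1 / 2) * (a3 + a6) * pdx (fun y s => pdx v y s * sin (n y s) ^ 2) x t
  + (1 / 2) * a4 * pdx (pdx v) x t

/-- `ELSystem γ a0 … a8 T ρ u v n` says that `(ρ, u, v, n)` is a smooth solution, with
positive density, of the one-dimensional compressible Ericksen–Leslie system on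
`[0,1] × [0,T]`, with the homogeneous boundary conditions
`u = v = 0`, `n_x = 0` at `x = 0, 1`. -/
def ELSystem (γ a0 a1 a2 a3 a4 a5 a6 a7 a8 T : ℝ) (ρ u v n : ℝ → ℝ → ℝ) : Prop :=
  ContDiff ℝ (⊤ : ℕ∞) (fun p : ℝ × ℝ => ρ p.1 p.2) ∧
  ContDiff ℝ (⊤ : ℕ∞) (fun p : ℝ × ℝ => u p.1 p.2) ∧
  ContDiff ℝ (⊤ : ℕ∞) (fun p : ℝ × ℝ => v p.1 p.2) ∧
  ContDiff ℝ (⊤ : ℕ∞) (fun p : ℝ × ℝ => n p.1 p.2) ∧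
  (∀ x ∈ Icc (0:ℝ) 1, ∀ t ∈ Icc (0:ℝ) T, 0 < ρ x t) ∧
  (∀ x ∈ Ioo (0:ℝ) 1, ∀ t ∈ Ioo (0:ℝ) T,
    pdt ρ x t + pdx (fun y s => ρ y s * u y s) x t = 0 ∧
    pdt (fun y s => ρ y s * u y s) x t + pdx (fun y s => ρ y s * u y s ^ 2) x t
        + pdx (fun y s => ρ y s ^ γ) x t
      = J1 a0 a1 a2 a3 a4 a5 a6 a7 a8 u v n x t - pdx (pdx n) x t * pdx n x t ∧
    pdt (fun y s => ρ y s * v y s) x t + pdx (fun y s => ρ y s * u y s * v y s) x t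
      = J2 a1 a2 a3 a4 a5 a6 a8 u v n x t ∧
    (a3 - a2) * (mdot u n x t - (1 / 2) * pdx v x t)
        - (a6 - a5) * (pdx u x t * cos (n x t) * sin (n x t)
            + (1 / 2) * pdx v x t * (1 - 2 * cos (n x t) ^ 2))
      = pdx (pdx n) x t) ∧
  (∀ t ∈ Icc (0:ℝ) T,
    u 0 t = 0 ∧ u 1 t = 0 ∧ v 0 t = 0 ∧ v 1 t = 0 ∧ pdx n 0 t = 0 ∧ pdx n 1 t = 0)

/-- The total energy `E(t)` of the one-dimensional compressible Ericksen–Leslie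
system. -/
def energy (γ : ℝ) (ρ u v n : ℝ → ℝ → ℝ) (t : ℝ) : ℝ :=
  (1 / 2) * (∫ x in (0:ℝ)..1, ρ x t * ((u x t) ^ 2 + (v x t) ^ 2))
  + (1 / (γ - 1)) * (∫ x in (0:ℝ)..1, ρ x t ^ γ)
  + (1 / 2) * (∫ x in (0:ℝ)..1, (pdx n x t) ^ 2)

def Sm (f : ℝ → ℝ → ℝ) : Prop := ContDiff ℝ (⊤ : ℕ∞) (fun p : ℝ × ℝ => f p.1 p.2)

def Cn (f : ℝ → ℝ → ℝ) : Prop := Continuous (fun p : ℝ × ℝ => f p.1 p.2)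

lemma Sm.cn {f : ℝ → ℝ → ℝ} (h : Sm f) : Cn f := ContDiff.continuous h

lemma Sm.hdx0 {f : ℝ → ℝ → ℝ} (h : Sm f) (x t : ℝ) :
    HasDerivAt (fun y => f y t) (fderiv ℝ (fun p : ℝ × ℝ => f p.1 p.2) (x, t) (1, 0)) x := by
  have h1 : DifferentiableAt ℝ (fun p : ℝ × ℝ => f p.1 p.2) (x, t) :=
    (ContDiff.differentiable h (by simp)) _
  have h2 : HasDerivAt (fun y : ℝ => (y, t)) ((1 : ℝ), (0 : ℝ)) x :=
    (hasDerivAt_id x).prodMk (hasDerivAt_const x t)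
  exact HasFDerivAt.comp_hasDerivAt (f := fun y : ℝ => (y, t)) x h1.hasFDerivAt h2

lemma Sm.hdt0 {f : ℝ → ℝ → ℝ} (h : Sm f) (x t : ℝ) :
    HasDerivAt (fun s => f x s) (fderiv ℝ (fun p : ℝ × ℝ => f p.1 p.2) (x, t) (0, 1)) t := by
  have h1 : DifferentiableAt ℝ (fun p : ℝ × ℝ => f p.1 p.2) (x, t) :=
    (ContDiff.differentiable h (by simp)) _
  have h2 : HasDerivAt (fun y : ℝ => (x, y)) ((0 : ℝ), (1 : ℝ)) t :=
    (hasDerivAt_const t x).prodMk (hasDerivAt_id t)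
  exact HasFDerivAt.comp_hasDerivAt (f := fun y : ℝ => (x, y)) t h1.hasFDerivAt h2

lemma Sm.pdx_eq {f : ℝ → ℝ → ℝ} (h : Sm f) (x t : ℝ) :
    pdx f x t = fderiv ℝ (fun p : ℝ × ℝ => f p.1 p.2) (x, t) (1, 0) := (h.hdx0 x t).deriv

lemma Sm.pdt_eq {f : ℝ → ℝ → ℝ} (h : Sm f) (x t : ℝ) :
    pdt f x t = fderiv ℝ (fun p : ℝ × ℝ => f p.1 p.2) (x, t) (0, 1) := (h.hdt0 x t).deriv

lemma Sm.hdx {f : ℝ → ℝ → ℝ} (h : Sm f) (x t : ℝ) :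
    HasDerivAt (fun y => f y t) (pdx f x t) x := by rw [h.pdx_eq]; exact h.hdx0 x t

lemma Sm.hdt {f : ℝ → ℝ → ℝ} (h : Sm f) (x t : ℝ) :
    HasDerivAt (fun y => f x y) (pdt f x t) t := by rw [h.pdt_eq]; exact h.hdt0 x t

lemma Sm.fd {f : ℝ → ℝ → ℝ} (h : Sm f) :
    ContDiff ℝ (⊤ : ℕ∞) (fderiv ℝ (fun p : ℝ × ℝ => f p.1 p.2)) :=
  ContDiff.fderiv_right (m := (⊤ : ℕ∞)) h (by simp)

lemma Sm.pdx {f : ℝ → ℝ → ℝ} (h : Sm f) : Sm (pdx f) := by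
  have : (fun p : ℝ × ℝ => _root_.pdx f p.1 p.2)
      = fun p => fderiv ℝ (fun p : ℝ × ℝ => f p.1 p.2) p (1, 0) := by
    funext p; exact h.pdx_eq p.1 p.2
  unfold Sm; rw [this]
  exact h.fd.clm_apply contDiff_const

lemma Sm.pdt {f : ℝ → ℝ → ℝ} (h : Sm f) : Sm (pdt f) := by
  have : (fun p : ℝ × ℝ => _root_.pdt f p.1 p.2)
      = fun p => fderiv ℝ (fun p : ℝ × ℝ => f p.1 p.2) p (0, 1) := by
    funext p; exact h.pdt_eq p.1 p.2
  unfold Sm; rw [this]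
  exact h.fd.clm_apply contDiff_const

lemma Sm.symm {f : ℝ → ℝ → ℝ} (h : Sm f) (x t : ℝ) :
    _root_.pdx (_root_.pdt f) x t = _root_.pdt (_root_.pdx f) x t := by
  have hd : DifferentiableAt ℝ (fderiv ℝ (fun p : ℝ × ℝ => f p.1 p.2)) (x, t) :=
    (h.fd.differentiable (by simp)) _
  rw [h.pdt.pdx_eq, h.pdx.pdt_eq]
  have e1 : (fun p : ℝ × ℝ => _root_.pdx f p.1 p.2)
      = fun p => fderiv ℝ (fun p : ℝ × ℝ => f p.1 p.2) p (1, 0) := by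
    funext p; exact h.pdx_eq p.1 p.2
  have e2 : (fun p : ℝ × ℝ => _root_.pdt f p.1 p.2)
      = fun p => fderiv ℝ (fun p : ℝ × ℝ => f p.1 p.2) p (0, 1) := by
    funext p; exact h.pdt_eq p.1 p.2
  rw [e1, e2, fderiv_clm_apply hd (differentiableAt_const _),
    fderiv_clm_apply hd (differentiableAt_const _)]
  have hs : IsSymmSndFDerivAt ℝ (fun p : ℝ × ℝ => f p.1 p.2) (x, t) :=
    (ContDiff.contDiffAt h).isSymmSndFDerivAt (by simpa using ENat.LEInfty.out)
  simp
  exact hs _ _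

/-- Fubini plus FTC in time. -/
lemma int_dt {F F' : ℝ → ℝ → ℝ} (hd : ∀ x t, HasDerivAt (fun s => F x s) (F' x t) t)
    (hc : Cn F') (a b : ℝ) (c d : ℝ) :
    (∫ t in c..d, ∫ x in a..b, F' x t) = ∫ x in a..b, (F x d - F x c) := by
  rw [MeasureTheory.intervalIntegral_intervalIntegral_swap]
  · refine intervalIntegral.integral_congr fun x _ => ?_
    refine intervalIntegral.integral_eq_sub_of_hasDerivAt (fun t _ => hd x t) ?_
    apply Continuous.intervalIntegrable
    exact hc.comp (by fun_prop : Continuous fun t : ℝ => (x, t))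
  · have h1 : Continuous (fun p : ℝ × ℝ => F' p.2 p.1) := hc.comp continuous_swap
    have h2 : MeasureTheory.IntegrableOn (fun p : ℝ × ℝ => F' p.2 p.1) (uIcc c d ×ˢ uIcc a b) :=
      h1.continuousOn.integrableOn_compact (isCompact_uIcc.prod isCompact_uIcc)
    exact h2.mono_set (Set.prod_mono uIoc_subset_uIcc uIoc_subset_uIcc)

lemma Cn.int {F : ℝ → ℝ → ℝ} (hc : Cn F) : Cn (fun x t => ∫ y in (0:ℝ)..x, F y t) := by
  have := intervalIntegral.continuous_parametric_intervalIntegral_of_continuous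
    (μ := MeasureTheory.volume) (a₀ := 0) (f := fun (p : ℝ × ℝ) y => F y p.2) (s := fun p => p.1)
    (hc.comp (by fun_prop : Continuous fun q : (ℝ × ℝ) × ℝ => (q.2, q.1.2))) continuous_fst
  exact this

lemma Cn.int1 {F : ℝ → ℝ → ℝ} (hc : Cn F) (a b : ℝ) : Continuous (fun t => ∫ y in a..b, F y t) := by
  have := intervalIntegral.continuous_parametric_intervalIntegral_of_continuous'
    (μ := MeasureTheory.volume) (f := fun (t : ℝ) y => F y t)
    (hc.comp (by fun_prop : Continuous fun q : ℝ × ℝ => (q.2, q.1))) a b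
  exact this

lemma int_dt_deriv {F F' : ℝ → ℝ → ℝ} (hd : ∀ x t, HasDerivAt (fun s => F x s) (F' x t) t)
    (hF : Cn F) (hc : Cn F') (a b t : ℝ) :
    HasDerivAt (fun s => ∫ y in a..b, F y s) (∫ y in a..b, F' y t) t := by
  have h1 : (fun s => ∫ y in a..b, F y s) =
      fun s => (∫ r in (0:ℝ)..s, ∫ x in a..b, F' x r) + ∫ y in a..b, F y 0 := by
    funext s
    have i1 : ∀ s, IntervalIntegrable (fun y => F y s) MeasureTheory.volume a b := fun s =>
      (hF.comp (by fun_prop : Continuous fun y : ℝ => (y, s))).intervalIntegrable _ _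
    rw [int_dt hd hc, intervalIntegral.integral_sub (i1 _) (i1 _)]
    ring
  rw [h1]
  have := (hc.int1 a b)
  exact (intervalIntegral.integral_hasDerivAt_right (this.intervalIntegrable _ _)
    this.stronglyMeasurable.stronglyMeasurableAtFilter this.continuousAt).add_const _

def Tone (a0 a1 a2 a3 a4 a5 a6 a7 a8 : ℝ) (u v n : ℝ → ℝ → ℝ) (y s : ℝ) : ℝ :=
  (a0 + a5 + a6 + a8) * (pdx u y s * cos (n y s) ^ 2)
  + a1 * (pdx u y s * cos (n y s) ^ 4)
  - (a2 + a3) * (mdot u n y s * cos (n y s) * sin (n y s))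
  + (a4 + a7) * (pdx u y s)
  + a0 * (pdx v y s * cos (n y s) * sin (n y s))
  + a1 * (pdx v y s * cos (n y s) ^ 3 * sin (n y s))
  + (1 / 2) * (a2 + a3 + a5 + a6) * (pdx v y s * cos (n y s) * sin (n y s))

def Ttwo (a1 a2 a3 a4 a5 a6 a8 : ℝ) (u v n : ℝ → ℝ → ℝ) (y s : ℝ) : ℝ :=
  a1 * (pdx u y s * cos (n y s) ^ 3 * sin (n y s))
  + a2 * (mdot u n y s * cos (n y s) ^ 2)
  - a3 * (mdot u n y s * sin (n y s) ^ 2)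
  + (a6 + a8) * (pdx u y s * cos (n y s) * sin (n y s))
  + a1 * (pdx v y s * cos (n y s) ^ 2 * sin (n y s) ^ 2)
  + (1 / 2) * (-a2 + a5) * (pdx v y s * cos (n y s) ^ 2)
  + (1 / 2) * (a3 + a6) * (pdx v y s * sin (n y s) ^ 2)
  + (1 / 2) * a4 * pdx v y s

lemma Sm.mdot {u n : ℝ → ℝ → ℝ} (hu : Sm u) (hn : Sm n) : Sm (mdot u n) := by
  have h1 := hn.pdx
  have h2 := hn.pdt
  unfold Sm at *
  unfold _root_.mdot
  fun_prop

lemma Sm.Tone {a0 a1 a2 a3 a4 a5 a6 a7 a8 : ℝ} {u v n : ℝ → ℝ → ℝ} (hu : Sm u) (hv : Sm v)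
    (hn : Sm n) : Sm (Tone a0 a1 a2 a3 a4 a5 a6 a7 a8 u v n) := by
  have h1 := hu.pdx
  have h2 := hv.pdx
  have h3 := hu.mdot hn
  unfold Sm at *
  unfold _root_.Tone
  fun_prop

lemma Sm.Ttwo {a1 a2 a3 a4 a5 a6 a8 : ℝ} {u v n : ℝ → ℝ → ℝ} (hu : Sm u) (hv : Sm v)
    (hn : Sm n) : Sm (Ttwo a1 a2 a3 a4 a5 a6 a8 u v n) := by
  have h1 := hu.pdx
  have h2 := hv.pdx
  have h3 := hu.mdot hn
  unfold Sm at *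
  unfold _root_.Ttwo
  fun_prop

lemma J1_eq {a0 a1 a2 a3 a4 a5 a6 a7 a8 : ℝ} {u v n : ℝ → ℝ → ℝ} (hu : Sm u) (hv : Sm v)
    (hn : Sm n) (x t : ℝ) : J1 a0 a1 a2 a3 a4 a5 a6 a7 a8 u v n x t =
      pdx (Tone a0 a1 a2 a3 a4 a5 a6 a7 a8 u v n) x t := by
  have h1 := hu.pdx
  have h2 := hv.pdx
  have h3 := hu.mdot hn
  have k1 : Sm (fun y s => pdx u y s * cos (n y s) ^ 2) := by unfold Sm at *; fun_prop
  have k2 : Sm (fun y s => pdx u y s * cos (n y s) ^ 4) := by unfold Sm at *; fun_prop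
  have k3 : Sm (fun y s => mdot u n y s * cos (n y s) * sin (n y s)) := by
    unfold Sm at *; fun_prop
  have k5 : Sm (fun y s => pdx v y s * cos (n y s) * sin (n y s)) := by
    unfold Sm at *; fun_prop
  have k6 : Sm (fun y s => pdx v y s * cos (n y s) ^ 3 * sin (n y s)) := by
    unfold Sm at *; fun_prop
  refine Eq.symm (HasDerivAt.deriv ?_)
  exact (((((((k1.hdx x t).const_mul _).add ((k2.hdx x t).const_mul _)).sub
    ((k3.hdx x t).const_mul _)).add ((h1.hdx x t).const_mul _)).add
    ((k5.hdx x t).const_mul _)).add ((k6.hdx x t).const_mul _)).add ((k5.hdx x t).const_mul _)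

lemma J2_eq {a1 a2 a3 a4 a5 a6 a8 : ℝ} {u v n : ℝ → ℝ → ℝ} (hu : Sm u) (hv : Sm v)
    (hn : Sm n) (x t : ℝ) : J2 a1 a2 a3 a4 a5 a6 a8 u v n x t =
      pdx (Ttwo a1 a2 a3 a4 a5 a6 a8 u v n) x t := by
  have h1 := hu.pdx
  have h2 := hv.pdx
  have h3 := hu.mdot hn
  have k1 : Sm (fun y s => pdx u y s * cos (n y s) ^ 3 * sin (n y s)) := by
    unfold Sm at *; fun_prop
  have k2 : Sm (fun y s => mdot u n y s * cos (n y s) ^ 2) := by unfold Sm at *; fun_prop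
  have k3 : Sm (fun y s => mdot u n y s * sin (n y s) ^ 2) := by
    unfold Sm at *; fun_prop
  have k4 : Sm (fun y s => pdx u y s * cos (n y s) * sin (n y s)) := by
    unfold Sm at *; fun_prop
  have k5 : Sm (fun y s => pdx v y s * cos (n y s) ^ 2 * sin (n y s) ^ 2) := by
    unfold Sm at *; fun_prop
  have k6 : Sm (fun y s => pdx v y s * cos (n y s) ^ 2) := by
    unfold Sm at *; fun_prop
  have k7 : Sm (fun y s => pdx v y s * sin (n y s) ^ 2) := by
    unfold Sm at *; fun_prop
  refine Eq.symm (HasDerivAt.deriv ?_)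
  exact ((((((((k1.hdx x t).const_mul _).add ((k2.hdx x t).const_mul _)).sub
    ((k3.hdx x t).const_mul _)).add ((k4.hdx x t).const_mul _)).add
    ((k5.hdx x t).const_mul _)).add ((k6.hdx x t).const_mul _)).add
    ((k7.hdx x t).const_mul _)).add ((h2.hdx x t).const_mul _)

lemma ext_rect {f g : ℝ → ℝ → ℝ} (hf : Cn f) (hg : Cn g) {T : ℝ} (hT : 0 < T)
    (h : ∀ x ∈ Ioo (0:ℝ) 1, ∀ t ∈ Ioo (0:ℝ) T, f x t = g x t) :
    ∀ x ∈ Icc (0:ℝ) 1, ∀ t ∈ Icc (0:ℝ) T, f x t = g x t := by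
  have h1 : EqOn (fun p : ℝ × ℝ => f p.1 p.2) (fun p : ℝ × ℝ => g p.1 p.2)
      (Ioo (0:ℝ) 1 ×ˢ Ioo (0:ℝ) T) := fun p hp => h _ hp.1 _ hp.2
  have h2 := h1.closure hf hg
  rw [closure_prod_eq, closure_Ioo (by norm_num), closure_Ioo hT.ne] at h2
  intro x hx t ht
  exact h2 (show (x, t) ∈ _ from ⟨hx, ht⟩)

/-- Expanded pointwise equations on the closed rectangle. -/
lemma expanded {γ a0 a1 a2 a3 a4 a5 a6 a7 a8 T : ℝ} {ρ u v n : ℝ → ℝ → ℝ} (hγ : 1 < γ)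
    (hT : 0 < T) (h : ELSystem γ a0 a1 a2 a3 a4 a5 a6 a7 a8 T ρ u v n) :
    ∀ x ∈ Icc (0:ℝ) 1, ∀ t ∈ Icc (0:ℝ) T,
      (pdt ρ x t + (pdx ρ x t * u x t + ρ x t * pdx u x t) = 0) ∧
      (pdt ρ x t * u x t + ρ x t * pdt u x t
        + (pdx ρ x t * u x t ^ 2 + ρ x t * (2 * u x t * pdx u x t))
        + γ * ρ x t ^ (γ - 1) * pdx ρ x t
        = pdx (Tone a0 a1 a2 a3 a4 a5 a6 a7 a8 u v n) x t - pdx (pdx n) x t * pdx n x t) ∧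
      (pdt ρ x t * v x t + ρ x t * pdt v x t
        + (pdx ρ x t * u x t * v x t + ρ x t * pdx u x t * v x t + ρ x t * u x t * pdx v x t)
        = pdx (Ttwo a1 a2 a3 a4 a5 a6 a8 u v n) x t) ∧
      ((a3 - a2) * (mdot u n x t - (1 / 2) * pdx v x t)
        - (a6 - a5) * (pdx u x t * cos (n x t) * sin (n x t)
            + (1 / 2) * pdx v x t * (1 - 2 * cos (n x t) ^ 2))
      = pdx (pdx n) x t) := by
  obtain ⟨hρ, hu, hv, hn, hpos, heq, hbd⟩ := h
  replace hρ : Sm ρ := hρ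
  replace hu : Sm u := hu
  replace hv : Sm v := hv
  replace hn : Sm n := hn
  have c0 := hρ.cn
  have c1 := hu.cn
  have c2 := hv.cn
  have c3 := hn.cn
  have c4 := hρ.pdx.cn
  have c5 := hu.pdx.cn
  have c6 := hv.pdx.cn
  have c7 := hn.pdx.cn
  have c8 := hρ.pdt.cn
  have c9 := hu.pdt.cn
  have c10 := hv.pdt.cn
  have c11 := hn.pdx.pdx.cn
  have c12 := (hu.mdot hn).cn
  have c13 := (Sm.Tone (a0 := a0) (a1 := a1) (a2 := a2) (a3 := a3) (a4 := a4) (a5 := a5)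
    (a6 := a6) (a7 := a7) (a8 := a8) hu hv hn).pdx.cn
  have c14 := (Sm.Ttwo (a1 := a1) (a2 := a2) (a3 := a3) (a4 := a4) (a5 := a5)
    (a6 := a6) (a8 := a8) hu hv hn).pdx.cn
  have c15 : Cn (fun x t => ρ x t ^ (γ - 1)) := by
    unfold Cn at *
    exact c0.rpow_const fun _ => Or.inr (by linarith)
  have E : ∀ x ∈ Ioo (0:ℝ) 1, ∀ t ∈ Ioo (0:ℝ) T,
      (pdt ρ x t + (pdx ρ x t * u x t + ρ x t * pdx u x t) = 0) ∧
      (pdt ρ x t * u x t + ρ x t * pdt u x t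
        + (pdx ρ x t * u x t ^ 2 + ρ x t * (2 * u x t * pdx u x t))
        + γ * ρ x t ^ (γ - 1) * pdx ρ x t
        = pdx (Tone a0 a1 a2 a3 a4 a5 a6 a7 a8 u v n) x t - pdx (pdx n) x t * pdx n x t) ∧
      (pdt ρ x t * v x t + ρ x t * pdt v x t
        + (pdx ρ x t * u x t * v x t + ρ x t * pdx u x t * v x t + ρ x t * u x t * pdx v x t)
        = pdx (Ttwo a1 a2 a3 a4 a5 a6 a8 u v n) x t) ∧
      ((a3 - a2) * (mdot u n x t - (1 / 2) * pdx v x t)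
        - (a6 - a5) * (pdx u x t * cos (n x t) * sin (n x t)
            + (1 / 2) * pdx v x t * (1 - 2 * cos (n x t) ^ 2))
      = pdx (pdx n) x t) := by
    intro x hx t ht
    obtain ⟨e1, e2, e3, e4⟩ := heq x hx t ht
    have d1 : pdx (fun y s => ρ y s * u y s) x t = pdx ρ x t * u x t + ρ x t * pdx u x t :=
      ((hρ.hdx x t).mul (hu.hdx x t)).deriv
    have d2 : pdt (fun y s => ρ y s * u y s) x t = pdt ρ x t * u x t + ρ x t * pdt u x t :=
      ((hρ.hdt x t).mul (hu.hdt x t)).deriv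
    have d3 : pdx (fun y s => ρ y s * u y s ^ 2) x t
        = pdx ρ x t * u x t ^ 2 + ρ x t * (2 * u x t * pdx u x t) := by
      refine HasDerivAt.deriv ?_
      exact ((hρ.hdx x t).mul ((hu.hdx x t).pow 2)).congr_deriv (by simp)
    have d4 : pdx (fun y s => ρ y s ^ γ) x t = γ * ρ x t ^ (γ - 1) * pdx ρ x t := by
      refine HasDerivAt.deriv ?_
      exact ((hρ.hdx x t).rpow_const (p := γ) (Or.inr hγ.le)).congr_deriv (by ring)
    have d5 : pdt (fun y s => ρ y s * v y s) x t = pdt ρ x t * v x t + ρ x t * pdt v x t :=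
      ((hρ.hdt x t).mul (hv.hdt x t)).deriv
    have d6 : pdx (fun y s => ρ y s * u y s * v y s) x t = pdx ρ x t * u x t * v x t
        + ρ x t * pdx u x t * v x t + ρ x t * u x t * pdx v x t := by
      refine HasDerivAt.deriv ?_
      exact (((hρ.hdx x t).mul (hu.hdx x t)).mul (hv.hdx x t)).congr_deriv (by simp; ring)
    rw [d1] at e1
    rw [d2, d3, d4, J1_eq hu hv hn] at e2
    rw [d5, d6, J2_eq hu hv hn] at e3
    exact ⟨e1, e2, e3, e4⟩
  intro x hx t ht
  refine ⟨?_, ?_, ?_, ?_⟩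
  · refine ext_rect (f := fun x t => pdt ρ x t + (pdx ρ x t * u x t + ρ x t * pdx u x t))
      (g := fun x t => 0) ?_ ?_ hT (fun x hx t ht => (E x hx t ht).1) x hx t ht <;>
      (unfold Cn at *; fun_prop)
  · refine ext_rect (f := fun x t => pdt ρ x t * u x t + ρ x t * pdt u x t
        + (pdx ρ x t * u x t ^ 2 + ρ x t * (2 * u x t * pdx u x t))
        + γ * ρ x t ^ (γ - 1) * pdx ρ x t)
      (g := fun x t => pdx (Tone a0 a1 a2 a3 a4 a5 a6 a7 a8 u v n) x t
        - pdx (pdx n) x t * pdx n x t) ?_ ?_ hT (fun x hx t ht => (E x hx t ht).2.1) x hx t ht <;>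
      (unfold Cn at *; fun_prop)
  · refine ext_rect (f := fun x t => pdt ρ x t * v x t + ρ x t * pdt v x t
        + (pdx ρ x t * u x t * v x t + ρ x t * pdx u x t * v x t + ρ x t * u x t * pdx v x t))
      (g := fun x t => pdx (Ttwo a1 a2 a3 a4 a5 a6 a8 u v n) x t) ?_ ?_ hT
      (fun x hx t ht => (E x hx t ht).2.2.1) x hx t ht <;>
      (unfold Cn at *; fun_prop)
  · refine ext_rect (f := fun x t => (a3 - a2) * (mdot u n x t - (1 / 2) * pdx v x t)
        - (a6 - a5) * (pdx u x t * cos (n x t) * sin (n x t)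
            + (1 / 2) * pdx v x t * (1 - 2 * cos (n x t) ^ 2)))
      (g := fun x t => pdx (pdx n) x t) ?_ ?_ hT
      (fun x hx t ht => (E x hx t ht).2.2.2) x hx t ht <;>
      (unfold Cn at *; fun_prop)

/-- Coercivity of the dissipation. -/
lemma coercive {a0 a1 a2 a3 a4 a5 a6 a7 a8 : ℝ}
    (hParodi : a6 - a5 = a2 + a3)
    (h3 : 0 < a3 - a2)
    (h6 : a1 + (a6 - a5) ^ 2 / (a3 - a2) < a4 + a7)
    (h6' : 0 ≤ a1 + (a6 - a5) ^ 2 / (a3 - a2))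
    (h7' : 0 ≤ a0 + a1 + a5 + a6 + a8) (s w N z c k : ℝ) (hck : c ^ 2 + k ^ 2 = 1)
    (hz : (a3 - a2) * (N - (1 / 2) * w)
        - (a6 - a5) * (s * c * k + (1 / 2) * w * (1 - 2 * c ^ 2)) = z) :
    (a4 + a7 - (a1 + (a6 - a5) ^ 2 / (a3 - a2))) * s ^ 2
      + (2 * a4 + a5 + a6 - (a6 - a5) ^ 2 / (a3 - a2) - (a0 + a1 + a5 + a6 + a8)) / 4 * w ^ 2
      + z ^ 2 / (a3 - a2)
    ≤ ((a0 + a5 + a6 + a8) * (s * c ^ 2) + a1 * (s * c ^ 4) - (a2 + a3) * (N * c * k)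
        + (a4 + a7) * s + a0 * (w * c * k) + a1 * (w * c ^ 3 * k)
        + (1 / 2) * (a2 + a3 + a5 + a6) * (w * c * k)) * s
      + (a1 * (s * c ^ 3 * k) + a2 * (N * c ^ 2) - a3 * (N * k ^ 2) + (a6 + a8) * (s * c * k)
        + a1 * (w * c ^ 2 * k ^ 2) + (1 / 2) * (-a2 + a5) * (w * c ^ 2)
        + (1 / 2) * (a3 + a6) * (w * k ^ 2) + (1 / 2) * a4 * w) * w
      + z * N := by
  obtain ⟨g, hg⟩ : ∃ g, g = a3 - a2 := ⟨_, rfl⟩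
  obtain ⟨r, hr⟩ : ∃ r, r = (a6 - a5) / g := ⟨_, rfl⟩
  have hg0 : 0 < g := hg ▸ h3
  have e1 : a6 - a5 = r * g := by rw [hr]; field_simp
  have e2 : (a6 - a5) ^ 2 / (a3 - a2) = r ^ 2 * g := by rw [← hg, e1]; field_simp
  have ha2 : a2 = (r * g - g) / 2 := by linarith
  have ha3 : a3 = (r * g + g) / 2 := by linarith
  have ha6 : a6 = a5 + r * g := by linarith
  rw [e2] at h6 h6' ⊢
  have hk : k ^ 2 = 1 - c ^ 2 := by linarith
  obtain ⟨b, hb⟩ : ∃ b, b = a1 + r ^ 2 * g := ⟨_, rfl⟩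
  obtain ⟨B, hB⟩ : ∃ B, B = a0 + a1 + a5 + a6 + a8 := ⟨_, rfl⟩
  have hz2 : z ^ 2 / (a3 - a2) = g * (N - w / 2 - r * (s * c * k + 1 / 2 * w * (1 - 2 * c ^ 2))) ^ 2 := by
    rw [← hz, ← hg, e1]; field_simp
  have q1 : 0 ≤ b * (c ^ 2 * (c * s + k * w) ^ 2 - c * s * (c * s + k * w) + s ^ 2) := by
    apply mul_nonneg (hb ▸ h6')
    have : c ^ 2 * (c * s + k * w) ^ 2 - c * s * (c * s + k * w) + s ^ 2
      = (c * (c * s + k * w) - s / 2) ^ 2 + 3 / 4 * s ^ 2 := by ring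
    rw [this]; positivity
  have q2 : 0 ≤ B * (c * s * (c * s + k * w) + w ^ 2 / 4) := by
    apply mul_nonneg (hB ▸ h7')
    have : c * s * (c * s + k * w) + w ^ 2 / 4
      = (c * s + k * w / 2) ^ 2 + (c * w) ^ 2 / 4 := by linear_combination (-w ^ 2 / 4) * hck
    rw [this]; positivity
  rw [hz2]
  have hz' : z = g * (N - w / 2 - r * (s * c * k + 1 / 2 * w * (1 - 2 * c ^ 2))) := by
    rw [← hz, ← hg, e1]; ring
  rw [hz']
  rw [← sub_nonneg]
  refine le_trans (add_nonneg q1 q2) (le_of_eq ?_)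
  rw [hb, hB, ha6, ha2, ha3]
  ring_nf
  simp only [hk]
  ring_nf

lemma coercive' {a0 a1 a2 a3 a4 a5 a6 a7 a8 : ℝ}
    (hParodi : a6 - a5 = a2 + a3)
    (h3 : 0 < a3 - a2)
    (h6 : a1 + (a6 - a5) ^ 2 / (a3 - a2) < a4 + a7)
    (h6' : 0 ≤ a1 + (a6 - a5) ^ 2 / (a3 - a2))
    (h7 : a0 + a1 + a5 + a6 + a8 < 2 * a4 + a5 + a6 - (a6 - a5) ^ 2 / (a3 - a2))
    (h7' : 0 ≤ a0 + a1 + a5 + a6 + a8) :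
    ∃ c1 : ℝ, 0 < c1 ∧ ∀ (u v n : ℝ → ℝ → ℝ) (x t : ℝ),
      (a3 - a2) * (mdot u n x t - (1 / 2) * pdx v x t)
        - (a6 - a5) * (pdx u x t * cos (n x t) * sin (n x t)
            + (1 / 2) * pdx v x t * (1 - 2 * cos (n x t) ^ 2))
      = pdx (pdx n) x t →
      c1 * (pdx u x t ^ 2 + pdx v x t ^ 2 + pdx (pdx n) x t ^ 2)
      ≤ Tone a0 a1 a2 a3 a4 a5 a6 a7 a8 u v n x t * pdx u x t
        + Ttwo a1 a2 a3 a4 a5 a6 a8 u v n x t * pdx v x t + pdx (pdx n) x t * mdot u n x t := by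
  obtain ⟨A, hA⟩ : ∃ A, A = a4 + a7 - (a1 + (a6 - a5) ^ 2 / (a3 - a2)) := ⟨_, rfl⟩
  obtain ⟨B, hB⟩ : ∃ B, B = (2 * a4 + a5 + a6 - (a6 - a5) ^ 2 / (a3 - a2)
    - (a0 + a1 + a5 + a6 + a8)) / 4 := ⟨_, rfl⟩
  have hA0 : 0 < A := by rw [hA]; linarith
  have hB0 : 0 < B := by rw [hB]; linarith
  have hC0 : 0 < 1 / (a3 - a2) := by positivity
  refine ⟨min A (min B (1 / (a3 - a2))), by positivity, fun u v n x t hz => ?_⟩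
  have := coercive hParodi h3 h6 h6' h7' _ _ _ _ _ _ (cos_sq_add_sin_sq (n x t)) hz
  rw [← hA, ← hB] at this
  refine le_trans ?_ this
  have m1 : min A (min B (1 / (a3 - a2))) ≤ A := min_le_left _ _
  have m2 : min A (min B (1 / (a3 - a2))) ≤ B := (min_le_right _ _).trans (min_le_left _ _)
  have m3 : min A (min B (1 / (a3 - a2))) ≤ 1 / (a3 - a2) :=
    (min_le_right _ _).trans (min_le_right _ _)
  have n1 := mul_le_mul_of_nonneg_right m1 (sq_nonneg (pdx u x t))
  have n2 := mul_le_mul_of_nonneg_right m2 (sq_nonneg (pdx v x t))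
  have n3 := mul_le_mul_of_nonneg_right m3 (sq_nonneg (pdx (pdx n) x t))
  have n4 : 1 / (a3 - a2) * pdx (pdx n) x t ^ 2 = pdx (pdx n) x t ^ 2 / (a3 - a2) := by ring
  linarith

lemma abs_mul_cs {a s θ b : ℝ} (hs : |s| ≤ b) (h : |θ| ≤ 1) : |a * (s * θ)| ≤ |a| * b := by
  rw [abs_mul, abs_mul]
  have : |s| * |θ| ≤ b * 1 := mul_le_mul hs h (abs_nonneg _) ((abs_nonneg _).trans hs)
  exact mul_le_mul_of_nonneg_left (by linarith) (abs_nonneg _)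

lemma abs7 {x1 x2 x3 x4 x5 x6 x7 k1 k2 k3 k4 k5 k6 k7 R : ℝ} (h1 : |x1| ≤ k1 * R)
    (h2 : |x2| ≤ k2 * R) (h3 : |x3| ≤ k3 * R) (h4 : |x4| ≤ k4 * R) (h5 : |x5| ≤ k5 * R)
    (h6 : |x6| ≤ k6 * R) (h7 : |x7| ≤ k7 * R) :
    |x1 + x2 + x3 + x4 + x5 + x6 + x7| ≤ (k1 + k2 + k3 + k4 + k5 + k6 + k7) * R := by
  rw [abs_le] at *
  constructor <;> linarith [h1.1, h1.2, h2.1, h2.2, h3.1, h3.2, h4.1, h4.2, h5.1, h5.2, h6.1, h6.2,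
    h7.1, h7.2]

lemma sq3 (a b c : ℝ) : (a + b + c) ^ 2 ≤ 3 * (a ^ 2 + b ^ 2 + c ^ 2) := by
  nlinarith [sq_nonneg (a - b), sq_nonneg (a - c), sq_nonneg (b - c)]

lemma stress_bound (a0 a1 a2 a3 a4 a5 a6 a7 a8 : ℝ) (h3 : 0 < a3 - a2) :
    ∃ K1 : ℝ, 0 ≤ K1 ∧ ∀ (u v n : ℝ → ℝ → ℝ) (x t : ℝ),
      (a3 - a2) * (mdot u n x t - (1 / 2) * pdx v x t)
        - (a6 - a5) * (pdx u x t * cos (n x t) * sin (n x t)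
            + (1 / 2) * pdx v x t * (1 - 2 * cos (n x t) ^ 2))
      = pdx (pdx n) x t →
      Tone a0 a1 a2 a3 a4 a5 a6 a7 a8 u v n x t ^ 2
        ≤ K1 * (pdx u x t ^ 2 + pdx v x t ^ 2 + pdx (pdx n) x t ^ 2) := by
  obtain ⟨k, hk⟩ : ∃ k, k = |a0 + a5 + a6 + a8| + |a1| + |-(a2 + a3)| + |a4 + a7| + |a0| + |a1|
    + |(1 / 2) * (a2 + a3 + a5 + a6)| := ⟨_, rfl⟩
  obtain ⟨kN, hkN⟩ : ∃ k, k = |1 / (a3 - a2)| + |1 / 2| + |(a6 - a5) / (a3 - a2)|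
    + |(a6 - a5) / (a3 - a2) / 2| := ⟨_, rfl⟩
  have hk0 : 0 ≤ k := by rw [hk]; positivity
  have hkN0 : 0 ≤ kN := by rw [hkN]; positivity
  refine ⟨3 * (k * (1 + kN)) ^ 2, by positivity, fun u v n x t hz => ?_⟩
  generalize hs : pdx u x t = s at *
  generalize hw : pdx v x t = w at *
  generalize hN : mdot u n x t = N at *
  generalize hzz : pdx (pdx n) x t = z at *
  unfold Tone
  rw [hs, hw, hN]
  have hc := abs_cos_le_one (n x t)
  have hσ := abs_sin_le_one (n x t)
  have hcs := cos_sq_add_sin_sq (n x t)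
  generalize cos (n x t) = c at *
  generalize sin (n x t) = σ at *
  obtain ⟨Q, hQ⟩ : ∃ Q, Q = |s| + |w| + |z| := ⟨_, rfl⟩
  have hsQ : |s| ≤ Q := by rw [hQ]; linarith [abs_nonneg w, abs_nonneg z]
  have hwQ : |w| ≤ Q := by rw [hQ]; linarith [abs_nonneg s, abs_nonneg z]
  have hzQ : |z| ≤ Q := by rw [hQ]; linarith [abs_nonneg w, abs_nonneg s]
  have hQ0 : 0 ≤ Q := (abs_nonneg _).trans hsQ
  have hcσ : |c * σ| ≤ 1 := by
    rw [abs_mul]; exact mul_le_one₀ hc (abs_nonneg _) hσ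
  have hpow : ∀ i : ℕ, |c ^ i| ≤ 1 := fun i => by
    rw [abs_pow]; exact pow_le_one₀ (abs_nonneg _) hc
  have hc3σ : |c ^ 3 * σ| ≤ 1 := by
    rw [abs_mul]; exact mul_le_one₀ (hpow 3) (abs_nonneg _) hσ
  have h2c : |1 - 2 * c ^ 2| ≤ 1 := by
    rw [abs_le]; constructor <;> nlinarith [sq_nonneg c, sq_nonneg σ]
  have hNe : N = 1 / (a3 - a2) * (z * 1) + 1 / 2 * (w * 1) + (a6 - a5) / (a3 - a2) * (s * (c * σ))
      + (a6 - a5) / (a3 - a2) / 2 * (w * (1 - 2 * c ^ 2)) := by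
    rw [← hz]; field_simp; ring
  have hNQ : |N| ≤ kN * Q := by
    have b1 := abs_mul_cs (a := 1 / (a3 - a2)) hzQ (abs_one (α := ℝ)).le
    have b2 := abs_mul_cs (a := 1 / 2) hwQ (abs_one (α := ℝ)).le
    have b3 := abs_mul_cs (a := (a6 - a5) / (a3 - a2)) hsQ hcσ
    have b4 := abs_mul_cs (a := (a6 - a5) / (a3 - a2) / 2) hwQ h2c
    rw [hNe]
    refine (abs_add_le _ _).trans ?_
    refine (add_le_add_left (abs_add_le _ _) _).trans ?_
    refine (add_le_add_left (add_le_add_left (abs_add_le _ _) _) _).trans ?_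
    rw [hkN]; linarith
  obtain ⟨R, hR⟩ : ∃ R, R = (1 + kN) * Q := ⟨_, rfl⟩
  have hp := mul_nonneg hkN0 hQ0
  have hsR : |s| ≤ R := by rw [hR]; linarith
  have hwR : |w| ≤ R := by rw [hR]; linarith
  have hNR : |N| ≤ R := by rw [hR]; linarith
  have t1 := abs_mul_cs (a := a0 + a5 + a6 + a8) hsR (hpow 2)
  have t2 := abs_mul_cs (a := a1) hsR (hpow 4)
  have t3 := abs_mul_cs (a := -(a2 + a3)) hNR hcσ
  have t4 := abs_mul_cs (a := a4 + a7) hsR (abs_one (α := ℝ)).le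
  have t5 := abs_mul_cs (a := a0) hwR hcσ
  have t6 := abs_mul_cs (a := a1) hwR hc3σ
  have t7 := abs_mul_cs (a := 1 / 2 * (a2 + a3 + a5 + a6)) hwR hcσ
  have hT : |(a0 + a5 + a6 + a8) * (s * c ^ 2) + a1 * (s * c ^ 4) - (a2 + a3) * (N * c * σ)
      + (a4 + a7) * s + a0 * (w * c * σ) + a1 * (w * c ^ 3 * σ)
      + (1 / 2) * (a2 + a3 + a5 + a6) * (w * c * σ)| ≤ k * R := by
    have e : (a0 + a5 + a6 + a8) * (s * c ^ 2) + a1 * (s * c ^ 4) - (a2 + a3) * (N * c * σ)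
      + (a4 + a7) * s + a0 * (w * c * σ) + a1 * (w * c ^ 3 * σ)
      + (1 / 2) * (a2 + a3 + a5 + a6) * (w * c * σ) =
      (a0 + a5 + a6 + a8) * (s * c ^ 2) + a1 * (s * c ^ 4) + -(a2 + a3) * (N * (c * σ))
      + (a4 + a7) * (s * 1) + a0 * (w * (c * σ)) + a1 * (w * (c ^ 3 * σ))
      + (1 / 2) * (a2 + a3 + a5 + a6) * (w * (c * σ)) := by ring
    rw [e, hk]
    exact abs7 t1 t2 t3 t4 t5 t6 t7
  have hQ2 : Q ^ 2 ≤ 3 * (s ^ 2 + w ^ 2 + z ^ 2) := by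
    rw [hQ, ← sq_abs s, ← sq_abs w, ← sq_abs z]
    exact sq3 _ _ _
  have := sq_le_sq' (abs_le.1 hT).1 (abs_le.1 hT).2
  refine this.trans ?_
  rw [hR]
  calc (k * ((1 + kN) * Q)) ^ 2 = (k * (1 + kN)) ^ 2 * Q ^ 2 := by ring
    _ ≤ (k * (1 + kN)) ^ 2 * (3 * (s ^ 2 + w ^ 2 + z ^ 2)) :=
      mul_le_mul_of_nonneg_left hQ2 (sq_nonneg _)
    _ = _ := by ring

lemma Cn.sl {f : ℝ → ℝ → ℝ} (hc : Cn f) (t : ℝ) : Continuous (fun x => f x t) :=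
  hc.comp (by fun_prop : Continuous fun y : ℝ => (y, t))

lemma Cn.ii {f : ℝ → ℝ → ℝ} (hc : Cn f) (t a b : ℝ) :
    IntervalIntegrable (fun x => f x t) MeasureTheory.volume a b :=
  (hc.sl t).intervalIntegrable _ _

lemma ftc_x {H H' : ℝ → ℝ → ℝ} (hd : ∀ x t, HasDerivAt (fun y => H y t) (H' x t) x)
    (hc : Cn H') (a b t : ℝ) : (∫ x in a..b, H' x t) = H b t - H a t :=
  intervalIntegral.integral_eq_sub_of_hasDerivAt (fun x _ => hd x t) (hc.ii t a b)

lemma energy_est {γ a0 a1 a2 a3 a4 a5 a6 a7 a8 T c1 : ℝ} {ρ u v n : ℝ → ℝ → ℝ} (hγ : 1 < γ)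
    (hT : 0 < T) (h : ELSystem γ a0 a1 a2 a3 a4 a5 a6 a7 a8 T ρ u v n)
    (hco : ∀ (u v n : ℝ → ℝ → ℝ) (x t : ℝ),
      (a3 - a2) * (mdot u n x t - (1 / 2) * pdx v x t)
        - (a6 - a5) * (pdx u x t * cos (n x t) * sin (n x t)
            + (1 / 2) * pdx v x t * (1 - 2 * cos (n x t) ^ 2))
      = pdx (pdx n) x t →
      c1 * (pdx u x t ^ 2 + pdx v x t ^ 2 + pdx (pdx n) x t ^ 2)
      ≤ Tone a0 a1 a2 a3 a4 a5 a6 a7 a8 u v n x t * pdx u x t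
        + Ttwo a1 a2 a3 a4 a5 a6 a8 u v n x t * pdx v x t + pdx (pdx n) x t * mdot u n x t)
    (τ : ℝ) (hτ : τ ∈ Icc 0 T) :
    energy γ ρ u v n τ + c1 * (∫ t in (0:ℝ)..τ, ∫ x in (0:ℝ)..1,
      (pdx u x t ^ 2 + pdx v x t ^ 2 + pdx (pdx n) x t ^ 2)) ≤ energy γ ρ u v n 0 := by
  have hex := expanded hγ hT h
  obtain ⟨hρ, hu, hv, hn, hpos, -, hbd⟩ := h
  replace hρ : Sm ρ := hρ
  replace hu : Sm u := hu
  replace hv : Sm v := hv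
  replace hn : Sm n := hn
  have s13 := (Sm.Tone (a0 := a0) (a1 := a1) (a2 := a2) (a3 := a3) (a4 := a4) (a5 := a5)
    (a6 := a6) (a7 := a7) (a8 := a8) hu hv hn)
  have s14 := (Sm.Ttwo (a1 := a1) (a2 := a2) (a3 := a3) (a4 := a4) (a5 := a5)
    (a6 := a6) (a8 := a8) hu hv hn)
  set T1 := Tone a0 a1 a2 a3 a4 a5 a6 a7 a8 u v n with hT1
  set T2 := Ttwo a1 a2 a3 a4 a5 a6 a8 u v n with hT2
  have c0 := hρ.cn
  have c1' := hu.cn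
  have c2 := hv.cn
  have c3 := hn.cn
  have c4 := hρ.pdx.cn
  have c5 := hu.pdx.cn
  have c6 := hv.pdx.cn
  have c7 := hn.pdx.cn
  have c8 := hρ.pdt.cn
  have c9 := hu.pdt.cn
  have c10 := hv.pdt.cn
  have c10' := hn.pdt.cn
  have c11 := hn.pdx.pdx.cn
  have c11' := hn.pdx.pdt.cn
  have c12 := (hu.mdot hn).cn
  have c13 := s13.cn
  have c14 := s14.cn
  have c13' := s13.pdx.cn
  have c14' := s14.pdx.cn
  have c15 : Cn (fun x t => ρ x t ^ (γ - 1)) := by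
    unfold Cn at *
    exact c0.rpow_const fun _ => Or.inr (by linarith)
  have c16 : Cn (fun x t => ρ x t ^ γ) := by
    unfold Cn at *
    exact c0.rpow_const fun _ => Or.inr (by linarith)
  have hg : 0 < γ - 1 := by linarith
  -- energy density
  let F : ℝ → ℝ → ℝ := fun x t => (1 / 2) * (ρ x t * ((u x t) ^ 2 + (v x t) ^ 2))
    + (1 / (γ - 1)) * ρ x t ^ γ + (1 / 2) * (pdx n x t) ^ 2
  let F' : ℝ → ℝ → ℝ := fun x t => (1 / 2) * (pdt ρ x t * ((u x t) ^ 2 + (v x t) ^ 2)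
      + ρ x t * (2 * u x t * pdt u x t + 2 * v x t * pdt v x t))
    + (1 / (γ - 1)) * (γ * ρ x t ^ (γ - 1) * pdt ρ x t)
    + (1 / 2) * (2 * pdx n x t * pdt (pdx n) x t)
  have hF : ∀ x t, HasDerivAt (fun s => F x s) (F' x t) t := by
    intro x t
    have d1 := ((hρ.hdt x t).mul (((hu.hdt x t).pow 2).add ((hv.hdt x t).pow 2))).const_mul (1 / 2)
    have d2 := ((hρ.hdt x t).rpow_const (p := γ) (Or.inr hγ.le)).const_mul (1 / (γ - 1))
    have d3 := ((hn.pdx.hdt x t).pow 2).const_mul (1 / 2)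
    exact ((d1.add d2).add d3).congr_deriv (by
      simp only [F', Pi.add_apply, Pi.pow_apply, Pi.mul_apply, Nat.cast_ofNat, Nat.reduceSub, pow_one]; ring)
  have hF'c : Cn F' := by unfold Cn at *; simp only [F']; fun_prop
  have hFc : Cn F := by unfold Cn at *; simp only [F]; fun_prop
  let H : ℝ → ℝ → ℝ := fun x t => (1 / 2) * (ρ x t * u x t * ((u x t) ^ 2 + (v x t) ^ 2))
    + (γ / (γ - 1)) * (ρ x t ^ γ * u x t) - T1 x t * u x t - T2 x t * v x t - pdx n x t * pdt n x t
  let H' : ℝ → ℝ → ℝ := fun x t => (1 / 2) * ((pdx ρ x t * u x t + ρ x t * pdx u x t)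
      * ((u x t) ^ 2 + (v x t) ^ 2)
      + ρ x t * u x t * (2 * u x t * pdx u x t + 2 * v x t * pdx v x t))
    + (γ / (γ - 1)) * (γ * ρ x t ^ (γ - 1) * pdx ρ x t * u x t + ρ x t ^ γ * pdx u x t)
    - (pdx T1 x t * u x t + T1 x t * pdx u x t) - (pdx T2 x t * v x t + T2 x t * pdx v x t)
    - (pdx (pdx n) x t * pdt n x t + pdx n x t * pdt (pdx n) x t)
  have hH : ∀ x t, HasDerivAt (fun y => H y t) (H' x t) x := by
    intro x t
    have d1 := (((hρ.hdx x t).mul (hu.hdx x t)).mul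
      (((hu.hdx x t).pow 2).add ((hv.hdx x t).pow 2))).const_mul (1 / 2)
    have d2 := (((hρ.hdx x t).rpow_const (p := γ) (Or.inr hγ.le)).mul
      (hu.hdx x t)).const_mul (γ / (γ - 1))
    have d3 := (s13.hdx x t).mul (hu.hdx x t)
    have d4 := (s14.hdx x t).mul (hv.hdx x t)
    have d5 := (hn.pdx.hdx x t).mul (hn.pdt.hdx x t)
    exact ((((d1.add d2).sub d3).sub d4).sub d5).congr_deriv (by
      simp only [H', hn.symm, Pi.add_apply, Pi.pow_apply, Pi.mul_apply, Nat.cast_ofNat, Nat.reduceSub, pow_one]; ring)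
  have hH'c : Cn H' := by unfold Cn at *; simp only [H']; fun_prop
  let S : ℝ → ℝ → ℝ := fun x t => pdx u x t ^ 2 + pdx v x t ^ 2 + pdx (pdx n) x t ^ 2
  have hSc : Cn S := by unfold Cn at *; simp only [S]; fun_prop
  have hpt : ∀ x ∈ Icc (0:ℝ) 1, ∀ t ∈ Icc (0:ℝ) T, F' x t + H' x t ≤ -c1 * S x t := by
    intro x hx t ht
    obtain ⟨e1, e2, e3, e4⟩ := hex x hx t ht
    have hc := hco u v n x t e4
    rw [← hT1, ← hT2] at hc
    have hp : ρ x t ^ γ = ρ x t ^ (γ - 1) * ρ x t := by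
      rw [← rpow_add_one (hpos x hx t ht).ne']; congr 1; ring
    have key : F' x t + H' x t = -(T1 x t * pdx u x t + T2 x t * pdx v x t
        + pdx (pdx n) x t * mdot u n x t) := by
      simp only [F', H', hp, mdot]
      have hγ1 : γ / (γ - 1) = 1 + 1 / (γ - 1) := by field_simp; ring
      have hγ2 : 1 / (γ - 1) * (γ - 1) = 1 := by field_simp
      rw [hγ1]
      generalize 1 / (γ - 1) = κ at *
      linear_combination (-(1 / 2) * (u x t ^ 2 + v x t ^ 2) + κ * γ * ρ x t ^ (γ - 1)) * e1
        + u x t * e2 + v x t * e3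
        + (ρ x t ^ (γ - 1) * (-(ρ x t * pdx u x t))) * hγ2
    rw [key]
    simp only [S]
    linarith
  have hsl : ∀ t ∈ Icc (0:ℝ) τ, (∫ x in (0:ℝ)..1, F' x t) ≤ -c1 * ∫ x in (0:ℝ)..1, S x t := by
    intro t ht
    have htT : t ∈ Icc (0:ℝ) T := ⟨ht.1, ht.2.trans hτ.2⟩
    have hz : (∫ x in (0:ℝ)..1, H' x t) = 0 := by
      rw [ftc_x hH hH'c]
      obtain ⟨b1, b2, b3, b4, b5, b6⟩ := hbd t htT
      simp [H, b1, b2, b3, b4, b5, b6]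
    have : (∫ x in (0:ℝ)..1, F' x t) = ∫ x in (0:ℝ)..1, (F' x t + H' x t) := by
      rw [intervalIntegral.integral_add (hF'c.ii t 0 1) (hH'c.ii t 0 1), hz, add_zero]
    rw [this, ← intervalIntegral.integral_const_mul]
    exact intervalIntegral.integral_mono_on zero_le_one
      ((hF'c.ii t 0 1).add (hH'c.ii t 0 1)) ((hSc.ii t 0 1).const_mul _)
      (fun x hx => hpt x hx t htT)
  have hint : (∫ t in (0:ℝ)..τ, ∫ x in (0:ℝ)..1, F' x t)
      ≤ -c1 * ∫ t in (0:ℝ)..τ, ∫ x in (0:ℝ)..1, S x t := by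
    rw [← intervalIntegral.integral_const_mul]
    exact intervalIntegral.integral_mono_on hτ.1 ((hF'c.int1 0 1).intervalIntegrable _ _)
      (((hSc.int1 0 1).intervalIntegrable _ _).const_mul _) hsl
  rw [int_dt hF hF'c, intervalIntegral.integral_sub (hFc.ii _ _ _) (hFc.ii _ _ _)] at hint
  have hE : ∀ t, energy γ ρ u v n t = ∫ x in (0:ℝ)..1, F x t := by
    intro t
    have k1 : Cn (fun x t => ρ x t * ((u x t) ^ 2 + (v x t) ^ 2)) := by unfold Cn at *; fun_prop
    have k3 : Cn (fun x t => (pdx n x t) ^ 2) := by unfold Cn at *; fun_prop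
    simp only [energy, F]
    rw [intervalIntegral.integral_add (((k1.ii t 0 1).const_mul _).add ((c16.ii t 0 1).const_mul _))
      ((k3.ii t 0 1).const_mul _),
      intervalIntegral.integral_add ((k1.ii t 0 1).const_mul _) ((c16.ii t 0 1).const_mul _),
      intervalIntegral.integral_const_mul, intervalIntegral.integral_const_mul,
      intervalIntegral.integral_const_mul]
  rw [hE, hE]
  linarith

lemma energy_parts {γ a0 a1 a2 a3 a4 a5 a6 a7 a8 T t e : ℝ} {ρ u v n : ℝ → ℝ → ℝ} (hγ : 1 < γ)
    (h : ELSystem γ a0 a1 a2 a3 a4 a5 a6 a7 a8 T ρ u v n) (ht : t ∈ Icc 0 T)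
    (he : energy γ ρ u v n t ≤ e) :
    0 ≤ energy γ ρ u v n t ∧
    (∫ x in (0:ℝ)..1, ρ x t * (u x t) ^ 2) ≤ 2 * e ∧
    (∫ x in (0:ℝ)..1, ρ x t ^ γ) ≤ (γ - 1) * e ∧ (∫ x in (0:ℝ)..1, (pdx n x t) ^ 2) ≤ 2 * e := by
  obtain ⟨hρ, hu, hv, hn, hpos, -, hbd⟩ := h
  replace hρ : Sm ρ := hρ
  replace hu : Sm u := hu
  replace hv : Sm v := hv
  have c0 := hρ.cn
  have c1 := hu.cn
  have c2 := hv.cn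
  have hg : 0 < γ - 1 := by linarith
  have k1 : Cn (fun x t => ρ x t * ((u x t) ^ 2 + (v x t) ^ 2)) := by unfold Cn at *; fun_prop
  have k2 : Cn (fun x t => ρ x t * (u x t) ^ 2) := by unfold Cn at *; fun_prop
  have m1 : (∫ x in (0:ℝ)..1, ρ x t * (u x t) ^ 2)
      ≤ ∫ x in (0:ℝ)..1, ρ x t * ((u x t) ^ 2 + (v x t) ^ 2) := by
    refine intervalIntegral.integral_mono_on zero_le_one (k2.ii t 0 1) (k1.ii t 0 1) fun x hx => ?_
    have := (hpos x hx t ht).le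
    nlinarith [mul_nonneg this (sq_nonneg (v x t))]
  have m0 : 0 ≤ (∫ x in (0:ℝ)..1, ρ x t * (u x t) ^ 2) :=
    intervalIntegral.integral_nonneg zero_le_one fun x hx =>
      mul_nonneg (hpos x hx t ht).le (sq_nonneg _)
  have m2 : 0 ≤ (∫ x in (0:ℝ)..1, ρ x t ^ γ) :=
    intervalIntegral.integral_nonneg zero_le_one fun x hx =>
      rpow_nonneg (hpos x hx t ht).le _
  have m3 : 0 ≤ (∫ x in (0:ℝ)..1, (pdx n x t) ^ 2) :=
    intervalIntegral.integral_nonneg zero_le_one fun x hx => sq_nonneg _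
  have m2' : 0 ≤ (1 / (γ - 1)) * (∫ x in (0:ℝ)..1, ρ x t ^ γ) := by positivity
  have q : (∫ x in (0:ℝ)..1, ρ x t ^ γ) = (γ - 1) * ((1 / (γ - 1)) * (∫ x in (0:ℝ)..1, ρ x t ^ γ)) := by
    field_simp
  unfold energy at *
  refine ⟨by linarith, by linarith, ?_, by linarith⟩
  rw [q]
  exact mul_le_mul_of_nonneg_left (by linarith) hg.le

lemma alg_bound' {P T1 s m K g : ℝ} (hm : |m| ≤ 2 * K) :
    -(g * P * s * m) + P * T1 ≤ (1 / 2) * P ^ 2 + T1 ^ 2 + 4 * K ^ 2 * g ^ 2 * s ^ 2 := by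
  have h1 : m ^ 2 ≤ (2 * K) ^ 2 := sq_le_sq' (abs_le.1 hm).1 (abs_le.1 hm).2
  have h2 := mul_le_mul_of_nonneg_right h1 (sq_nonneg (g * s))
  nlinarith [sq_nonneg (P / 2 - T1), sq_nonneg (P / 2 + g * s * m)]

lemma main_est {γ a0 a1 a2 a3 a4 a5 a6 a7 a8 T K1 c1 e : ℝ} {ρ u v n : ℝ → ℝ → ℝ} (hγ : 1 < γ)
    (hT : 0 < T) (h : ELSystem γ a0 a1 a2 a3 a4 a5 a6 a7 a8 T ρ u v n)
    (hK1 : 0 ≤ K1) (hc1 : 0 < c1)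
    (hst : ∀ (u v n : ℝ → ℝ → ℝ) (x t : ℝ),
      (a3 - a2) * (mdot u n x t - (1 / 2) * pdx v x t)
        - (a6 - a5) * (pdx u x t * cos (n x t) * sin (n x t)
            + (1 / 2) * pdx v x t * (1 - 2 * cos (n x t) ^ 2))
      = pdx (pdx n) x t →
      Tone a0 a1 a2 a3 a4 a5 a6 a7 a8 u v n x t ^ 2
        ≤ K1 * (pdx u x t ^ 2 + pdx v x t ^ 2 + pdx (pdx n) x t ^ 2))
    (hen : ∀ τ ∈ Icc 0 T, energy γ ρ u v n τ ≤ e)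
    (hdis : c1 * (∫ t in (0:ℝ)..T, ∫ x in (0:ℝ)..1,
      (pdx u x t ^ 2 + pdx v x t ^ 2 + pdx (pdx n) x t ^ 2)) ≤ e) :
    (∫ t in (0:ℝ)..T, ∫ x in (0:ℝ)..1, ρ x t ^ (2 * γ)) ≤
      2 * (4 * ((1 + (γ - 1) * e + 2 * e) / 2) * ((γ - 1) * e)
        + (K1 + 4 * ((1 + (γ - 1) * e + 2 * e) / 2) ^ 2 * (γ - 1) ^ 2 + (γ - 1) * e * K1) * (e / c1)
        + (γ - 1) * e * (3 * e + (γ - 1) * e + 1) * T) := by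
  have hparts := fun t ht => energy_parts hγ h ht (hen t ht)
  have hex := expanded hγ hT h
  obtain ⟨hρ, hu, hv, hn, hpos, -, hbd⟩ := h
  replace hρ : Sm ρ := hρ
  replace hu : Sm u := hu
  replace hv : Sm v := hv
  replace hn : Sm n := hn
  have s13 := (Sm.Tone (a0 := a0) (a1 := a1) (a2 := a2) (a3 := a3) (a4 := a4) (a5 := a5)
    (a6 := a6) (a7 := a7) (a8 := a8) hu hv hn)
  replace hst := hst u v n
  set T1 := Tone a0 a1 a2 a3 a4 a5 a6 a7 a8 u v n with hT1
  clear_value T1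
  have c0 := hρ.cn
  have c1' := hu.cn
  have c4 := hρ.pdx.cn
  have c5 := hu.pdx.cn
  have c6 := hv.pdx.cn
  have c7 := hn.pdx.cn
  have c8 := hρ.pdt.cn
  have c9 := hu.pdt.cn
  have c11 := hn.pdx.pdx.cn
  have c13 := s13.cn
  have c13' := s13.pdx.cn
  have c15 : Cn (fun x t => ρ x t ^ (γ - 1)) := by
    unfold Cn at *
    exact c0.rpow_const fun _ => Or.inr (by linarith)
  have c16 : Cn (fun x t => ρ x t ^ γ) := by
    unfold Cn at *
    exact c0.rpow_const fun _ => Or.inr (by linarith)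
  have hg : 0 < γ - 1 := by linarith
  have he : 0 ≤ e := (hparts 0 ⟨le_rfl, hT.le⟩).1.trans (hen 0 ⟨le_rfl, hT.le⟩)
  obtain ⟨K, hK⟩ : ∃ K, K = (1 + (γ - 1) * e + 2 * e) / 2 := ⟨_, rfl⟩
  rw [← hK]
  have hK0 : 0 ≤ K := by rw [hK]; positivity
  -- momentum
  let f : ℝ → ℝ → ℝ := fun x t => ρ x t * u x t
  let f' : ℝ → ℝ → ℝ := fun x t => pdt ρ x t * u x t + ρ x t * pdt u x t
  have hf : ∀ x t, HasDerivAt (fun s => f x s) (f' x t) t := fun x t => (hρ.hdt x t).mul (hu.hdt x t)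
  have hfc : Cn f := by unfold Cn at *; simp only [f]; fun_prop
  have hf'c : Cn f' := by unfold Cn at *; simp only [f']; fun_prop
  have hfw : ∀ x t, HasDerivAt (fun s => (1 - x) * f x s) ((1 - x) * f' x t) t :=
    fun x t => (hf x t).const_mul _
  have hfwc : Cn (fun x t => (1 - x) * f x t) := by unfold Cn at *; fun_prop
  have hfw'c : Cn (fun x t => (1 - x) * f' x t) := by unfold Cn at *; fun_prop
  let m : ℝ → ℝ → ℝ := fun x t => (∫ y in (0:ℝ)..x, f y t) - ∫ y in (0:ℝ)..1, (1 - y) * f y t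
  let m' : ℝ → ℝ → ℝ := fun x t => (∫ y in (0:ℝ)..x, f' y t) - ∫ y in (0:ℝ)..1, (1 - y) * f' y t
  have hmt : ∀ x t, HasDerivAt (fun s => m x s) (m' x t) t := fun x t =>
    (int_dt_deriv hf hfc hf'c 0 x t).sub (int_dt_deriv hfw hfwc hfw'c 0 1 t)
  have hmx : ∀ x t, HasDerivAt (fun y => m y t) (f x t) x := fun x t =>
    (intervalIntegral.integral_hasDerivAt_right (hfc.ii t 0 x)
      (hfc.sl t).stronglyMeasurable.stronglyMeasurableAtFilter (hfc.sl t).continuousAt).sub_const _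
  have hmc : Cn m := by
    have := (hfwc.int1 0 1).comp (continuous_snd : Continuous (Prod.snd : ℝ × ℝ → ℝ))
    exact hfc.int.sub this
  have hm'c : Cn m' := by
    have := (hfw'c.int1 0 1).comp (continuous_snd : Continuous (Prod.snd : ℝ × ℝ → ℝ))
    exact hf'c.int.sub this
  -- bound on m
  have hku : Cn (fun x t => ρ x t * (u x t) ^ 2) := by unfold Cn at *; fun_prop
  have hkn : Cn (fun x t => (pdx n x t) ^ 2) := by unfold Cn at *; fun_prop
  have hkb : Cn (fun x t => (1 + ρ x t ^ γ + ρ x t * (u x t) ^ 2) / 2) := by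
    unfold Cn at *; fun_prop
  have hmb : ∀ x ∈ Icc (0:ℝ) 1, ∀ t ∈ Icc (0:ℝ) T, |m x t| ≤ 2 * K := by
    intro x hx t ht
    have hfb : ∀ y ∈ Icc (0:ℝ) 1, |f y t| ≤ (1 + ρ y t ^ γ + ρ y t * (u y t) ^ 2) / 2 := by
      intro y hy
      have hr := hpos y hy t ht
      have h1 : ρ y t ≤ 1 + ρ y t ^ γ := by
        rcases le_total (ρ y t) 1 with h1 | h1
        · have := rpow_nonneg hr.le γ
          linarith
        · have := rpow_le_rpow_of_exponent_le h1 hγ.le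
          rw [rpow_one] at this
          linarith
      have h2 : |f y t| ≤ (ρ y t + ρ y t * (u y t) ^ 2) / 2 := by
        simp only [f]
        rw [abs_mul, abs_of_pos hr, ← sq_abs (u y t)]
        nlinarith [mul_nonneg hr.le (sq_nonneg (|u y t| - 1))]
      linarith
    have hIK : (∫ y in (0:ℝ)..1, (1 + ρ y t ^ γ + ρ y t * (u y t) ^ 2) / 2) ≤ K := by
      rw [intervalIntegral.integral_div, intervalIntegral.integral_add
        ((intervalIntegrable_const).add (c16.ii t 0 1)) (hku.ii t 0 1),
        intervalIntegral.integral_add intervalIntegrable_const (c16.ii t 0 1)]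
      obtain ⟨-, p1, p2, -⟩ := hparts t ht
      rw [hK]
      simp
      linarith
    have b1 : |∫ y in (0:ℝ)..x, f y t| ≤ K := by
      refine (intervalIntegral.abs_integral_le_integral_abs hx.1).trans ?_
      refine le_trans ?_ hIK
      refine (intervalIntegral.integral_mono_on hx.1 ((hfc.sl t).abs.intervalIntegrable _ _)
        (hkb.ii t 0 x) fun y hy => hfb y ⟨hy.1, hy.2.trans hx.2⟩).trans ?_
      refine intervalIntegral.integral_mono_interval le_rfl hx.1 hx.2 ?_ (hkb.ii t 0 1)
      refine (MeasureTheory.ae_restrict_mem measurableSet_Ioc).mono fun y hy => ?_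
      exact (abs_nonneg _).trans (hfb y ⟨hy.1.le, hy.2⟩)
    have b2 : |∫ y in (0:ℝ)..1, (1 - y) * f y t| ≤ K := by
      refine (intervalIntegral.abs_integral_le_integral_abs zero_le_one).trans ?_
      refine le_trans ?_ hIK
      refine intervalIntegral.integral_mono_on zero_le_one
        ((hfwc.sl t).abs.intervalIntegrable _ _) (hkb.ii t 0 1) fun y hy => ?_
      refine le_trans ?_ (hfb y hy)
      rw [abs_mul, abs_of_nonneg (by linarith [hy.2])]
      exact mul_le_of_le_one_left (abs_nonneg _) (by linarith [hy.1])
    have := abs_sub (∫ y in (0:ℝ)..x, f y t) (∫ y in (0:ℝ)..1, (1 - y) * f y t)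
    simp only [m]
    linarith
  -- flux
  let G : ℝ → ℝ → ℝ := fun x t => ρ x t * u x t ^ 2 + ρ x t ^ γ - T1 x t + (1 / 2) * pdx n x t ^ 2
  let G' : ℝ → ℝ → ℝ := fun x t => (pdx ρ x t * u x t ^ 2 + ρ x t * (2 * u x t * pdx u x t))
    + γ * ρ x t ^ (γ - 1) * pdx ρ x t - pdx T1 x t + pdx (pdx n) x t * pdx n x t
  have hG : ∀ x t, HasDerivAt (fun y => G y t) (G' x t) x := by
    intro x t
    have d1 := (hρ.hdx x t).mul ((hu.hdx x t).pow 2)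
    have d2 := (hρ.hdx x t).rpow_const (p := γ) (Or.inr hγ.le)
    have d3 := ((hn.pdx.hdx x t).pow 2).const_mul (1 / 2)
    exact (((d1.add d2).sub (s13.hdx x t)).add d3).congr_deriv (by
      simp only [G', Pi.add_apply, Pi.pow_apply, Pi.mul_apply, Nat.cast_ofNat, Nat.reduceSub,
        pow_one]; ring)
  have hGc : Cn G := by unfold Cn at *; simp only [G]; fun_prop
  have hG'c : Cn G' := by unfold Cn at *; simp only [G']; fun_prop
  have hfG : ∀ x ∈ Icc (0:ℝ) 1, ∀ t ∈ Icc (0:ℝ) T, f' x t = -G' x t := by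
    intro x hx t ht
    obtain ⟨-, e2, -, -⟩ := hex x hx t ht
    simp only [f', G']
    linarith
  have hm' : ∀ x ∈ Icc (0:ℝ) 1, ∀ t ∈ Icc (0:ℝ) T,
      m' x t = (∫ y in (0:ℝ)..1, G y t) - G x t := by
    intro x hx t ht
    have i1 : (∫ y in (0:ℝ)..x, f' y t) = G 0 t - G x t := by
      have : (∫ y in (0:ℝ)..x, f' y t) = ∫ y in (0:ℝ)..x, -G' y t := by
        refine intervalIntegral.integral_congr fun y hy => ?_
        rw [uIcc_of_le hx.1] at hy
        exact hfG y ⟨hy.1, hy.2.trans hx.2⟩ t ht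
      rw [this, intervalIntegral.integral_neg, ftc_x hG hG'c]; ring
    have i2 : (∫ y in (0:ℝ)..1, (1 - y) * f' y t) = G 0 t - ∫ y in (0:ℝ)..1, G y t := by
      have : (∫ y in (0:ℝ)..1, (1 - y) * f' y t)
          = ∫ y in (0:ℝ)..1, -(((1 - y) * G' y t - G y t) + G y t) := by
        refine intervalIntegral.integral_congr fun y hy => ?_
        rw [uIcc_of_le zero_le_one] at hy
        show (1 - y) * f' y t = -(((1 - y) * G' y t - G y t) + G y t)
        rw [hfG y hy t ht]; ring
      have kc : Cn (fun y t => (1 - y) * G' y t - G y t) := by unfold Cn at *; fun_prop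
      have kd : ∀ x t, HasDerivAt (fun y => (1 - y) * G y t) ((1 - x) * G' x t - G x t) x := by
        intro x t
        exact (((hasDerivAt_id x).const_sub 1).mul (hG x t)).congr_deriv (by simp; ring)
      rw [this, intervalIntegral.integral_neg,
        intervalIntegral.integral_add (kc.ii t 0 1) (hGc.ii t 0 1), ftc_x kd kc]
      ring
    simp only [m', i1, i2]; ring
  -- test
  let F : ℝ → ℝ → ℝ := fun x t => ρ x t ^ γ * m x t
  let F' : ℝ → ℝ → ℝ := fun x t => γ * ρ x t ^ (γ - 1) * pdt ρ x t * m x t + ρ x t ^ γ * m' x t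
  have hF : ∀ x t, HasDerivAt (fun s => F x s) (F' x t) t := by
    intro x t
    have d2 := (hρ.hdt x t).rpow_const (p := γ) (Or.inr hγ.le)
    exact (d2.mul (hmt x t)).congr_deriv (by simp only [F']; ring)
  have hFc : Cn F := by unfold Cn at *; simp only [F]; fun_prop
  have hF'c : Cn F' := by unfold Cn at *; simp only [F']; fun_prop
  let H : ℝ → ℝ → ℝ := fun x t => ρ x t ^ γ * u x t * m x t
  let H' : ℝ → ℝ → ℝ := fun x t => (γ * ρ x t ^ (γ - 1) * pdx ρ x t * u x t
    + ρ x t ^ γ * pdx u x t) * m x t + ρ x t ^ γ * u x t * f x t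
  have hH : ∀ x t, HasDerivAt (fun y => H y t) (H' x t) x := by
    intro x t
    have d2 := (hρ.hdx x t).rpow_const (p := γ) (Or.inr hγ.le)
    exact ((d2.mul (hu.hdx x t)).mul (hmx x t)).congr_deriv (by
      simp only [H', Pi.mul_apply]; ring)
  have hH'c : Cn H' := by unfold Cn at *; simp only [H']; fun_prop
  let S : ℝ → ℝ → ℝ := fun x t => pdx u x t ^ 2 + pdx v x t ^ 2 + pdx (pdx n) x t ^ 2
  have hSc : Cn S := by unfold Cn at *; simp only [S]; fun_prop
  have hS0 : ∀ x t, 0 ≤ S x t := fun x t => by simp only [S]; positivity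
  have hTS : ∀ x ∈ Icc (0:ℝ) 1, ∀ t ∈ Icc (0:ℝ) T, T1 x t ^ 2 ≤ K1 * S x t :=
    fun x hx t ht => hst x t (hex x hx t ht).2.2.2
  have hGb : ∀ t ∈ Icc (0:ℝ) T, (∫ y in (0:ℝ)..1, G y t)
      ≤ 3 * e + (γ - 1) * e + 1 + K1 * ∫ y in (0:ℝ)..1, S y t := by
    intro t ht
    obtain ⟨-, p1, p2, p3⟩ := hparts t ht
    have : (∫ y in (0:ℝ)..1, G y t) ≤ ∫ y in (0:ℝ)..1, (ρ y t * u y t ^ 2 + ρ y t ^ γ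
        + (1 / 2) * pdx n y t ^ 2 + (1 + K1 * S y t)) := by
      refine intervalIntegral.integral_mono_on zero_le_one (hGc.ii t 0 1) ?_ fun y hy => ?_
      · exact (((hku.ii t 0 1).add (c16.ii t 0 1)).add ((hkn.ii t 0 1).const_mul _)).add
          (intervalIntegrable_const.add ((hSc.ii t 0 1).const_mul _))
      · have := hTS y hy t ht
        simp only [G]
        nlinarith [sq_nonneg (T1 y t + 1)]
    rw [intervalIntegral.integral_add
      (((hku.ii t 0 1).add (c16.ii t 0 1)).add ((hkn.ii t 0 1).const_mul _))
      (intervalIntegrable_const.add ((hSc.ii t 0 1).const_mul _)),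
      intervalIntegral.integral_add ((hku.ii t 0 1).add (c16.ii t 0 1)) ((hkn.ii t 0 1).const_mul _),
      intervalIntegral.integral_add (hku.ii t 0 1) (c16.ii t 0 1),
      intervalIntegral.integral_add intervalIntegrable_const ((hSc.ii t 0 1).const_mul _),
      intervalIntegral.integral_const_mul, intervalIntegral.integral_const_mul,
      intervalIntegral.integral_const] at this
    simp only [sub_zero, one_smul] at this
    linarith
  -- pointwise inequality
  obtain ⟨L, hL⟩ : ∃ L, L = K1 + 4 * K ^ 2 * (γ - 1) ^ 2 := ⟨_, rfl⟩
  have hL0 : 0 ≤ L := by rw [hL]; positivity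
  let Sb : ℝ → ℝ := fun t => ∫ x in (0:ℝ)..1, S x t
  have hSb0 : ∀ t, 0 ≤ Sb t := fun t =>
    intervalIntegral.integral_nonneg zero_le_one fun x _ => hS0 x t
  have hpt : ∀ x ∈ Icc (0:ℝ) 1, ∀ t ∈ Icc (0:ℝ) T, (1 / 2) * ρ x t ^ (2 * γ) ≤
      -(F' x t + H' x t) + L * S x t + (3 * e + (γ - 1) * e + 1 + K1 * Sb t) * ρ x t ^ γ := by
    intro x hx t ht
    obtain ⟨e1, e2, e3, e4⟩ := hex x hx t ht
    have hr := hpos x hx t ht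
    have hp : ρ x t ^ (γ - 1) * ρ x t = ρ x t ^ γ := by
      rw [← rpow_add_one hr.ne']; congr 1; ring
    have hp2 : ρ x t ^ (2 * γ) = (ρ x t ^ γ) ^ 2 := by
      rw [← rpow_natCast, ← rpow_mul hr.le]; congr 1; push_cast; ring
    have hP0 : 0 ≤ ρ x t ^ γ := rpow_nonneg hr.le _
    have key : F' x t + H' x t = -((γ - 1) * ρ x t ^ γ * pdx u x t * m x t)
        + ρ x t ^ γ * (∫ y in (0:ℝ)..1, G y t) - (ρ x t ^ γ) ^ 2 + ρ x t ^ γ * T1 x t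
        - (1 / 2) * ρ x t ^ γ * pdx n x t ^ 2 := by
      simp only [F', H', hm' x hx t ht]
      simp only [G, f]
      linear_combination (γ * ρ x t ^ (γ - 1) * m x t) * e1 - γ * pdx u x t * m x t * hp
    have a1 := alg_bound' (P := ρ x t ^ γ) (T1 := T1 x t) (s := pdx u x t) (g := γ - 1)
      (hmb x hx t ht)
    have a2 := mul_le_mul_of_nonneg_left (hGb t ht) hP0
    have a3 := hTS x hx t ht
    have a4 : 4 * K ^ 2 * (γ - 1) ^ 2 * pdx u x t ^ 2 ≤ 4 * K ^ 2 * (γ - 1) ^ 2 * S x t := by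
      refine mul_le_mul_of_nonneg_left ?_ (by positivity)
      simp only [S]
      linarith [sq_nonneg (pdx v x t), sq_nonneg (pdx (pdx n) x t)]
    have a5 : 0 ≤ (1 / 2) * ρ x t ^ γ * pdx n x t ^ 2 := by positivity
    rw [hp2, key, hL]
    simp only [Sb]
    linarith
  have hkP : Cn (fun x t => ρ x t ^ (2 * γ)) := by
    unfold Cn at *
    exact c0.rpow_const fun _ => Or.inr (by linarith)
  have hsl : ∀ t ∈ Icc (0:ℝ) T, (1 / 2) * (∫ x in (0:ℝ)..1, ρ x t ^ (2 * γ)) ≤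
      -(∫ x in (0:ℝ)..1, F' x t) + (L + (γ - 1) * e * K1) * Sb t
        + (γ - 1) * e * (3 * e + (γ - 1) * e + 1) := by
    intro t ht
    have hz : (∫ x in (0:ℝ)..1, H' x t) = 0 := by
      rw [ftc_x hH hH'c]
      obtain ⟨b1, b2, -⟩ := hbd t ht
      simp [H, b1, b2]
    obtain ⟨-, p1, p2, p3⟩ := hparts t ht
    have i1 := ((hF'c.ii t 0 1).add (hH'c.ii t 0 1))
    have i2 := (hSc.ii t 0 1).const_mul L
    have i3 := (c16.ii t 0 1).const_mul (3 * e + (γ - 1) * e + 1 + K1 * Sb t)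
    have := intervalIntegral.integral_mono_on zero_le_one ((hkP.ii t 0 1).const_mul (1 / 2))
      ((i1.neg.add i2).add i3) (fun x hx => hpt x hx t ht)
    have e1 : (∫ x in (0:ℝ)..1, (-(F' x t + H' x t) + L * S x t
        + (3 * e + (γ - 1) * e + 1 + K1 * Sb t) * ρ x t ^ γ))
        = -(∫ x in (0:ℝ)..1, F' x t) + L * Sb t
          + (3 * e + (γ - 1) * e + 1 + K1 * Sb t) * ∫ x in (0:ℝ)..1, ρ x t ^ γ := by
      have q1 := intervalIntegral.integral_add (i1.neg.add i2) i3
      have q2 := intervalIntegral.integral_add i1.neg i2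
      have q3 := intervalIntegral.integral_add (hF'c.ii t 0 1) (hH'c.ii t 0 1)
      refine q1.trans ?_
      rw [intervalIntegral.integral_const_mul]
      congr 1
      refine q2.trans ?_
      rw [intervalIntegral.integral_const_mul]
      congr 1
      refine (intervalIntegral.integral_neg).trans ?_
      congr 1
      refine q3.trans ?_
      rw [hz, add_zero]
    have t1 : (1 / 2) * (∫ x in (0:ℝ)..1, ρ x t ^ (2 * γ)) ≤ -(∫ x in (0:ℝ)..1, F' x t) + L * Sb t
          + (3 * e + (γ - 1) * e + 1 + K1 * Sb t) * ∫ x in (0:ℝ)..1, ρ x t ^ γ := by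
      rw [← e1, ← intervalIntegral.integral_const_mul]
      exact this
    have t2 : 0 ≤ 3 * e + (γ - 1) * e + 1 + K1 * Sb t := by
      have := hSb0 t
      positivity
    have t3 := mul_le_mul_of_nonneg_left p2 t2
    linarith
  have hSbc : Continuous Sb := hSc.int1 0 1
  have j1 := (hF'c.int1 0 1).intervalIntegrable (μ := MeasureTheory.volume) 0 T
  have j2 := (hSbc.intervalIntegrable (μ := MeasureTheory.volume) 0 T).const_mul
    (L + (γ - 1) * e * K1)
  have j3 : IntervalIntegrable (fun _ : ℝ => (γ - 1) * e * (3 * e + (γ - 1) * e + 1))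
    MeasureTheory.volume 0 T := intervalIntegrable_const
  have hfin := intervalIntegral.integral_mono_on hT.le
    (((hkP.int1 0 1).intervalIntegrable (μ := MeasureTheory.volume) 0 T).const_mul (1 / 2))
    ((j1.neg.add j2).add j3) hsl
  have efin : (∫ t in (0:ℝ)..T, (-(∫ x in (0:ℝ)..1, F' x t) + (L + (γ - 1) * e * K1) * Sb t
        + (γ - 1) * e * (3 * e + (γ - 1) * e + 1)))
      = -(∫ x in (0:ℝ)..1, (F x T - F x 0)) + (L + (γ - 1) * e * K1) * (∫ t in (0:ℝ)..T, Sb t)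
        + (γ - 1) * e * (3 * e + (γ - 1) * e + 1) * T := by
    refine (intervalIntegral.integral_add (j1.neg.add j2) j3).trans ?_
    rw [intervalIntegral.integral_const]
    refine congrArg₂ (· + ·) ?_ (by simp; ring)
    refine (intervalIntegral.integral_add j1.neg j2).trans ?_
    rw [intervalIntegral.integral_const_mul]
    congr 1
    refine (intervalIntegral.integral_neg).trans ?_
    rw [int_dt hF hF'c]
  rw [intervalIntegral.integral_const_mul] at hfin
  replace hfin := hfin.trans_eq efin
  have hFb : ∀ t ∈ Icc (0:ℝ) T, |∫ x in (0:ℝ)..1, F x t| ≤ 2 * K * ((γ - 1) * e) := by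
    intro t ht
    obtain ⟨-, p1, p2, p3⟩ := hparts t ht
    refine (intervalIntegral.abs_integral_le_integral_abs zero_le_one).trans ?_
    refine le_trans ?_ (mul_le_mul_of_nonneg_left p2 (by positivity))
    rw [← intervalIntegral.integral_const_mul]
    refine intervalIntegral.integral_mono_on zero_le_one
        ((hFc.sl t).abs.intervalIntegrable _ _) ((c16.ii t 0 1).const_mul _) fun y hy => ?_
    have hP0 : 0 ≤ ρ y t ^ γ := rpow_nonneg (hpos y hy t ht).le _
    simp only [F]
    rw [abs_mul, abs_of_nonneg hP0, mul_comm]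
    exact mul_le_mul_of_nonneg_right (hmb y hy t ht) hP0
  rw [intervalIntegral.integral_sub (hFc.ii _ _ _) (hFc.ii _ _ _)] at hfin
  have f1 := (abs_le.1 (hFb T ⟨hT.le, le_rfl⟩)).1
  have f2 := (abs_le.1 (hFb 0 ⟨le_rfl, hT.le⟩)).2
  have f3 : (∫ t in (0:ℝ)..T, Sb t) ≤ e / c1 := by
    rw [le_div_iff₀ hc1, mul_comm]
    exact hdis
  have f4 : 0 ≤ L + (γ - 1) * e * K1 := by positivity
  have f5 := mul_le_mul_of_nonneg_left f3 f4
  rw [← hL]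
  linarith

/-- Under the Parodi relation and the empirical inequalities on the
Leslie coefficients, there is a nonnegative function `C` of the initial energy and the
time such that every smooth positive-density solution of the one-dimensional
compressible Ericksen–Leslie system on `[0,1] × [0,T]` satisfies the higher
integrability estimate `∫₀ᵀ∫₀¹ ρ^{2γ} ≤ C(E(0), T)`. -/
theorem density_higher_integrability
    (γ a0 a1 a2 a3 a4 a5 a6 a7 a8 : ℝ)
    (hγ : 1 < γ)
    (hParodi : a6 - a5 = a2 + a3)
    (h1 : 0 < a4)
    (h2 : 0 < 2 * a1 + 3 * a4 + 2 * a5 + 2 * a6)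
    (h3 : 0 < a3 - a2)
    (h4 : 0 < 2 * a4 + a5 + a6)
    (h5 : (a2 + a3 + (a6 - a5)) ^ 2 < 4 * (a3 - a2) * (2 * a4 + a5 + a6))
    (h6 : a1 + (a6 - a5) ^ 2 / (a3 - a2) < a4 + a7)
    (h6' : 0 ≤ a1 + (a6 - a5) ^ 2 / (a3 - a2))
    (h7 : a0 + a1 + a5 + a6 + a8 < 2 * a4 + a5 + a6 - (a6 - a5) ^ 2 / (a3 - a2))
    (h7' : 0 ≤ a0 + a1 + a5 + a6 + a8) :
    ∃ C : ℝ → ℝ → ℝ, (∀ e T, 0 ≤ C e T) ∧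
      ∀ T : ℝ, 0 < T → ∀ ρ u v n : ℝ → ℝ → ℝ,
        ELSystem γ a0 a1 a2 a3 a4 a5 a6 a7 a8 T ρ u v n →
          (∫ t in (0:ℝ)..T, ∫ x in (0:ℝ)..1, ρ x t ^ (2 * γ))
            ≤ C (energy γ ρ u v n 0) T := by
  obtain ⟨c1, hc1, hco⟩ := coercive' hParodi h3 h6 h6' h7 h7'
  obtain ⟨K1, hK1, hst⟩ := stress_bound a0 a1 a2 a3 a4 a5 a6 a7 a8 h3
  refine ⟨fun e T => |2 * (4 * ((1 + (γ - 1) * e + 2 * e) / 2) * ((γ - 1) * e)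
        + (K1 + 4 * ((1 + (γ - 1) * e + 2 * e) / 2) ^ 2 * (γ - 1) ^ 2 + (γ - 1) * e * K1) * (e / c1)
        + (γ - 1) * e * (3 * e + (γ - 1) * e + 1) * T)|, fun e T => abs_nonneg _, ?_⟩
  intro T hT ρ u v n h
  refine le_trans ?_ (le_abs_self _)
  refine main_est hγ hT h hK1 hc1 hst ?_ ?_
  · intro τ hτ
    have := energy_est hγ hT h hco τ hτ
    have h0 : 0 ≤ ∫ t in (0:ℝ)..τ, ∫ x in (0:ℝ)..1,
        (pdx u x t ^ 2 + pdx v x t ^ 2 + pdx (pdx n) x t ^ 2) :=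
      intervalIntegral.integral_nonneg hτ.1 fun t _ =>
        intervalIntegral.integral_nonneg zero_le_one fun x _ => by positivity
    have h0' := mul_nonneg hc1.le h0
    linarith
  · have := energy_est hγ hT h hco T ⟨hT.le, le_rfl⟩
    have h0 := (energy_parts hγ h (t := T) ⟨hT.le, le_rfl⟩ le_rfl).1
    linarith

end
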